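/- For every q-ary DMC W (q = 2^r), the symmetric capacity satisfies the upper bound I(W) ≤ Σ_{i=1}^{r} √(1 − Z_i(W)²). -/

import Mathlib

open Finset

instance (r : ℕ) : NeZero (2 ^ r) := ⟨pow_ne_zero r two_ne_zero⟩

/-- The Bhattacharyya parameter `Z(W; x, x') = ∑_y √(W x y · W x' y)` of a pair of inputs. -/
noncomputable def bhat {q : ℕ} {Y : Type*} [Fintype Y] (W : ZMod q → Y → ℝ) (x x' : ZMod q) : ℝ :=
  ∑ y, Real.sqrt (W x y * W x' y)

/-- `Z_v(W) = (1/q) ∑_x Z(W; x, x+v)`. -/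
noncomputable def Zv {q : ℕ} [NeZero q] {Y : Type*} [Fintype Y] (W : ZMod q → Y → ℝ) (v : ZMod q) : ℝ :=
  (1 / (q : ℝ)) * ∑ x, bhat W x (x + v)

/-- `W` is a discrete memoryless channel: nonnegative entries and rows summing to one. -/
def IsDMC {q : ℕ} {Y : Type*} [Fintype Y] (W : ZMod q → Y → ℝ) : Prop :=
  (∀ x y, 0 ≤ W x y) ∧ ∀ x, ∑ y, W x y = 1

/-- The ordered weight `wt(v) = r - ν₂(v̄)` of `v : ZMod (2^r)`. -/
def owt (r : ℕ) {q : ℕ} (v : ZMod q) : ℕ := r - padicValNat 2 v.val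

/-- The `i`-th average Bhattacharyya distance `Z_i(W) = 2^{-(i-1)} ∑_{v ∈ X_i} Z_v(W)`. -/
noncomputable def Zi (r : ℕ) {Y : Type*} [Fintype Y] (W : ZMod (2 ^ r) → Y → ℝ) (i : ℕ) : ℝ :=
  (1 / 2 ^ (i - 1) : ℝ) *
    ∑ v ∈ univ.filter (fun v : ZMod (2 ^ r) => v ≠ 0 ∧ owt r v = i), Zv W v

/-- The symmetric capacity `I(W)` (with `0 log 0 = 0`). -/
noncomputable def symCap {q : ℕ} [NeZero q] {Y : Type*} [Fintype Y] (W : ZMod q → Y → ℝ) : ℝ :=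
  ∑ x, ∑ y, (1 / (q : ℝ)) * W x y *
    Real.logb 2 (W x y / ∑ x', (1 / (q : ℝ)) * W x' y)

/-- `Z_max^{(j)}(W) = max_{v ∈ X_j} Z_v(W)` (as a supremum over the finite nonempty class `X_j`). -/
noncomputable def Zmax (r : ℕ) {Y : Type*} [Fintype Y] (W : ZMod (2 ^ r) → Y → ℝ) (j : ℕ) : ℝ :=
  ⨆ v : {v : ZMod (2 ^ r) // v ≠ 0 ∧ owt r v = j}, Zv W v.1

/-- The Arıkan minus transform `W⁻ u₁ (y₁,y₂) = (1/q) ∑_{u₂} W (u₁+u₂) y₁ · W u₂ y₂`. -/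
noncomputable def Wminus {q : ℕ} [NeZero q] {Y : Type*} [Fintype Y] (W : ZMod q → Y → ℝ) :
    ZMod q → Y × Y → ℝ :=
  fun u₁ p => (1 / (q : ℝ)) * ∑ u₂, W (u₁ + u₂) p.1 * W u₂ p.2

/-- The Arıkan plus transform `W⁺ u₂ (y₁,y₂,u₁) = (1/q) W (u₁+u₂) y₁ · W u₂ y₂`. -/
noncomputable def Wplus {q : ℕ} [NeZero q] {Y : Type*} [Fintype Y] (W : ZMod q → Y → ℝ) :
    ZMod q → Y × Y × ZMod q → ℝ :=
  fun u₂ p => (1 / (q : ℝ)) * W (p.2.2 + u₂) p.1 * W u₂ p.2.1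

/-- The restricted channel `W^{[r-k]}` for the `r-k` least significant bits. -/
noncomputable def Wres (r k : ℕ) {Y : Type*} [Fintype Y] (W : ZMod (2 ^ r) → Y → ℝ) :
    ZMod (2 ^ (r - k)) → Y → ℝ :=
  fun u y => (1 / 2 ^ k : ℝ) *
    ∑ x ∈ univ.filter (fun x : ZMod (2 ^ r) => x.val % 2 ^ (r - k) = u.val), W x y

theorem bin_aux {u v : ℝ} (hu : 0 ≤ u) (huv : u ≤ v) :
    Real.log 2 * (2 * u) ≤ Real.negMulLog u + Real.negMulLog v - Real.negMulLog (u + v) := by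
  rcases eq_or_lt_of_le (add_nonneg hu (hu.trans huv)) with h | hs
  · have h1 : u = 0 := by linarith
    have h2 : v = 0 := by linarith
    simp [h1, h2]
  · obtain ⟨s, hsd⟩ : ∃ s, s = u + v := ⟨_, rfl⟩
    rw [← hsd] at hs ⊢
    obtain ⟨p, hp⟩ : ∃ p, p = u / s := ⟨_, rfl⟩
    have hup : u = s * p := by rw [hp]; field_simp
    have hvp : v = s * (1 - p) := by linarith
    have hp0 : 0 ≤ p := by rw [hp]; positivity
    have hp1 : 2 * p ≤ 1 := by
      rw [hp, ← mul_div_assoc, div_le_one hs]; linarith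
    have hc := Real.strictConcave_binEntropy.concaveOn.2 (show (0:ℝ) ∈ Set.Icc (0:ℝ) 1 by simp)
      (show (2⁻¹:ℝ) ∈ Set.Icc (0:ℝ) 1 by constructor <;> norm_num)
      (show 0 ≤ 1 - 2 * p by linarith) (show 0 ≤ 2 * p by linarith) (by ring)
    simp only [smul_eq_mul, Real.binEntropy_zero, Real.binEntropy_two_inv, mul_zero, zero_add] at hc
    have e : 2 * p * 2⁻¹ = p := by ring
    rw [e, Real.binEntropy_eq_negMulLog_add_negMulLog_one_sub] at hc
    rw [hvp, hup, Real.negMulLog_mul, Real.negMulLog_mul]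
    have := mul_le_mul_of_nonneg_left hc hs.le
    linarith

theorem bin_aux2 {u v : ℝ} (hu : 0 ≤ u) (hv : 0 ≤ v) :
    Real.log 2 * (u + v - |u - v|) ≤
      Real.negMulLog u + Real.negMulLog v - Real.negMulLog (u + v) := by
  rcases le_total u v with h | h
  · have := bin_aux hu h
    rw [abs_of_nonpos (by linarith)]
    convert this using 2
    ring
  · have := bin_aux hv h
    rw [abs_of_nonneg (by linarith), add_comm u v]
    have e : v + u - (u - v) = 2 * v := by ring
    rw [e]
    linarith

/-- Sum over the residue class of `a` mod `2^k`. -/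
noncomputable def cosetSum (r k : ℕ) (f : ZMod (2 ^ r) → ℝ) (a : ℕ) : ℝ :=
  ∑ x ∈ univ.filter (fun x : ZMod (2 ^ r) => x.val % 2 ^ k = a), f x

theorem mod_split (n k a : ℕ) (ha : a < 2 ^ k) :
    n % 2 ^ k = a ↔ (n % 2 ^ (k+1) = a ∨ n % 2 ^ (k+1) = a + 2 ^ k) := by
  have h1 : n % 2 ^ (k+1) % 2 ^ k = n % 2 ^ k := Nat.mod_mod_of_dvd _ (pow_dvd_pow 2 (by omega))
  have h2 : n % 2 ^ (k+1) < 2 ^ (k+1) := Nat.mod_lt _ (by positivity)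
  rw [← h1]
  generalize n % 2 ^ (k+1) = m at *
  rw [pow_succ] at h2
  constructor
  · intro h
    rcases lt_or_ge m (2 ^ k) with h3 | h3
    · left; rwa [Nat.mod_eq_of_lt h3] at h
    · right
      rw [Nat.mod_eq_sub_mod h3, Nat.mod_eq_of_lt (by omega)] at h
      omega
  · rintro (h | h)
    · rw [h, Nat.mod_eq_of_lt ha]
    · rw [h, Nat.add_mod_right, Nat.mod_eq_of_lt ha]

theorem cosetSum_split (r k : ℕ) (f : ZMod (2 ^ r) → ℝ) (a : ℕ) (ha : a < 2 ^ k) :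
    cosetSum r k f a = cosetSum r (k+1) f a + cosetSum r (k+1) f (a + 2 ^ k) := by
  unfold cosetSum
  rw [← sum_union]
  · apply sum_congr _ (fun _ _ => rfl)
    ext x
    simp [mod_split _ k a ha]
  · rw [disjoint_filter]
    intro x _ h1 h2
    have : 0 < 2 ^ k := by positivity
    omega

theorem range_split (k : ℕ) (g : ℕ → ℝ) :
    ∑ b ∈ range (2 ^ (k+1)), g b = ∑ a ∈ range (2 ^ k), (g a + g (a + 2 ^ k)) := by
  rw [pow_succ, mul_two, sum_range_add, sum_add_distrib]
  simp [add_comm]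

theorem cosetSum_nonneg (r k : ℕ) {f : ZMod (2 ^ r) → ℝ} (hf : ∀ x, 0 ≤ f x) (a : ℕ) :
    0 ≤ cosetSum r k f a := sum_nonneg (fun x _ => hf x)

theorem sum_cosetSum (r k : ℕ) (f : ZMod (2 ^ r) → ℝ) :
    ∑ a ∈ range (2 ^ k), cosetSum r k f a = ∑ x, f x := by
  unfold cosetSum
  apply sum_fiberwise_of_maps_to
  intro x _
  simp only [mem_range]
  exact Nat.mod_lt _ (by positivity)

theorem cosetSum_top (r : ℕ) (f : ZMod (2 ^ r) → ℝ) (x : ZMod (2 ^ r)) :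
    cosetSum r r f x.val = f x := by
  unfold cosetSum
  rw [show (univ.filter (fun z : ZMod (2 ^ r) => z.val % 2 ^ r = x.val)) = {x} from ?_]
  · simp
  · ext z
    simp only [mem_filter, mem_univ, true_and, mem_singleton]
    rw [Nat.mod_eq_of_lt (ZMod.val_lt z)]
    exact (ZMod.val_injective _).eq_iff

theorem sum_range_top (r : ℕ) (g : ℕ → ℝ) :
    ∑ a ∈ range (2 ^ r), g a = ∑ x : ZMod (2 ^ r), g x.val := by
  symm
  apply sum_bij (fun x _ => x.val)
  · intro x _; simpa using ZMod.val_lt x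
  · intro x _ z _ h; exact ZMod.val_injective _ h
  · intro b hb
    exact ⟨(b : ZMod (2 ^ r)), mem_univ _, ZMod.val_cast_of_lt (by simpa using hb)⟩
  · intros; rfl

theorem card_coset (r k a : ℕ) (hk : k ≤ r) :
    (univ.filter (fun x : ZMod (2 ^ r) => x.val % 2 ^ k = a)).card ≤ 2 ^ (r - k) := by
  rw [← card_range (2 ^ (r - k))]
  apply card_le_card_of_injOn (fun x => x.val / 2 ^ k)
  · intro x _
    simp only [coe_range, Set.mem_Iio]
    rw [Nat.div_lt_iff_lt_mul (by positivity), ← pow_add, Nat.sub_add_cancel hk]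
    exact ZMod.val_lt x
  · intro x hx z hz h
    simp only [coe_filter, mem_univ, true_and, Set.mem_ofPred_eq] at hx hz
    simp only at h
    apply ZMod.val_injective
    rw [← Nat.div_add_mod x.val (2 ^ k), ← Nat.div_add_mod z.val (2 ^ k), hx, hz, h]

theorem sqrt_coset (r k a : ℕ) (hk : k ≤ r) {f : ZMod (2 ^ r) → ℝ} (hf : ∀ x, 0 ≤ f x) :
    cosetSum r k (fun x => √(f x)) a ≤ √(2 ^ (r - k)) * √(cosetSum r k f a) := by
  rw [← Real.sqrt_mul (by positivity)]
  apply Real.le_sqrt_of_sq_le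
  unfold cosetSum
  refine sq_sum_le_card_mul_sum_sq.trans ?_
  simp only [Real.sq_sqrt (hf _)]
  apply mul_le_mul_of_nonneg_right _ (sum_nonneg (fun x _ => hf x))
  exact_mod_cast card_coset r k a hk

/-- `∑_{x ≡ x' mod 2^k} g x g x' = ∑_a S_k(a)^2`. -/
theorem pair_sum (r k : ℕ) (g : ZMod (2 ^ r) → ℝ) :
    ∑ x, ∑ x', (if x.val % 2 ^ k = x'.val % 2 ^ k then g x * g x' else 0)
      = ∑ a ∈ range (2 ^ k), cosetSum r k g a ^ 2 := by
  have : ∀ x, ∑ x', (if x.val % 2 ^ k = x'.val % 2 ^ k then g x * g x' else 0)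
      = g x * cosetSum r k g (x.val % 2 ^ k) := by
    intro x
    rw [← sum_filter, cosetSum, mul_sum]
    apply sum_congr _ (fun _ _ => rfl)
    ext z
    simp [eq_comm]
  simp only [this]
  rw [← sum_cosetSum r k]
  apply sum_congr rfl
  intro a _
  rw [sq]
  conv_rhs => rw [cosetSum, sum_mul]
  unfold cosetSum
  apply sum_congr rfl
  intro x hx
  simp only [mem_filter, mem_univ, true_and] at hx
  subst hx
  rfl

theorem pair_diff (r k : ℕ) (g : ZMod (2 ^ r) → ℝ) :
    ∑ x, ∑ x', (if x.val % 2 ^ k = x'.val % 2 ^ k ∧ x.val % 2 ^ (k+1) ≠ x'.val % 2 ^ (k+1)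
        then g x * g x' else 0)
      = ∑ a ∈ range (2 ^ k), 2 * (cosetSum r (k+1) g a * cosetSum r (k+1) g (a + 2 ^ k)) := by
  have h1 : ∀ x x' : ZMod (2 ^ r),
      (if x.val % 2 ^ k = x'.val % 2 ^ k ∧ x.val % 2 ^ (k+1) ≠ x'.val % 2 ^ (k+1)
        then g x * g x' else 0)
      = (if x.val % 2 ^ k = x'.val % 2 ^ k then g x * g x' else 0)
        - (if x.val % 2 ^ (k+1) = x'.val % 2 ^ (k+1) then g x * g x' else 0) := by
    intro x x'
    by_cases h : x.val % 2 ^ (k+1) = x'.val % 2 ^ (k+1)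
    · have h2 : x.val % 2 ^ k = x'.val % 2 ^ k := by
        rw [← Nat.mod_mod_of_dvd x.val (pow_dvd_pow 2 (Nat.le_succ k)),
          ← Nat.mod_mod_of_dvd x'.val (pow_dvd_pow 2 (Nat.le_succ k)), h]
      simp [h, h2]
    · simp [h]
  simp only [h1, sum_sub_distrib]
  rw [pair_sum, pair_sum, range_split, ← sum_sub_distrib]
  apply sum_congr rfl
  intro a ha
  rw [cosetSum_split r k g a (by simpa using ha)]
  ring

theorem wt_pair (r k : ℕ) (hk : k < r) (x v : ZMod (2 ^ r)) (hv : v ≠ 0) (h : owt r v = r - k) :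
    x.val % 2 ^ k = (x + v).val % 2 ^ k ∧ x.val % 2 ^ (k+1) ≠ (x + v).val % 2 ^ (k+1) := by
  have hv0 : v.val ≠ 0 := by simpa [ZMod.val_eq_zero] using hv
  unfold owt at h
  have hp : padicValNat 2 v.val = k := by omega
  have d1 : 2 ^ k ∣ v.val := hp ▸ pow_padicValNat_dvd
  have d2 : ¬ 2 ^ (k+1) ∣ v.val := hp ▸ pow_succ_padicValNat_not_dvd hv0
  rw [ZMod.val_add, Nat.mod_mod_of_dvd _ (pow_dvd_pow 2 hk.le),
    Nat.mod_mod_of_dvd _ (pow_dvd_pow 2 (Nat.succ_le_of_lt hk))]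
  constructor
  · have := (Nat.modEq_iff_dvd' (n := 2 ^ k) (Nat.le_add_right x.val v.val)).2 (by simpa using d1)
    exact this
  · intro h
    have := (Nat.modEq_iff_dvd' (n := 2 ^ (k+1)) (Nat.le_add_right x.val v.val)).1 h
    exact d2 (by simpa using this)

theorem per_y_Z (r k : ℕ) (hk : k < r) {f : ZMod (2 ^ r) → ℝ} (hf : ∀ x, 0 ≤ f x) :
    ∑ v ∈ univ.filter (fun v : ZMod (2 ^ r) => v ≠ 0 ∧ owt r v = r - k),
      ∑ x, √(f x * f (x + v)) ≤
    2 ^ (r - k - 1) * (2 * ∑ a ∈ range (2 ^ k),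
      √(cosetSum r (k+1) f a) * √(cosetSum r (k+1) f (a + 2 ^ k))) := by
  calc _ = ∑ x, ∑ v, (if v ≠ 0 ∧ owt r v = r - k then √(f x) * √(f (x + v)) else 0) := by
        rw [sum_filter, sum_comm]
        apply sum_congr rfl
        intro v _
        split_ifs
        · simp only [Real.sqrt_mul (hf _)]
        · simp
    _ ≤ ∑ x, ∑ v, (if x.val % 2 ^ k = (x + v).val % 2 ^ k ∧
          x.val % 2 ^ (k+1) ≠ (x + v).val % 2 ^ (k+1) then √(f x) * √(f (x + v)) else 0) := by
        apply sum_le_sum; intro x _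
        apply sum_le_sum; intro v _
        by_cases h : v ≠ 0 ∧ owt r v = r - k
        · rw [if_pos h, if_pos (wt_pair r k hk x v h.1 h.2)]
        · rw [if_neg h]
          split_ifs <;> positivity
    _ = ∑ x, ∑ x', (if x.val % 2 ^ k = x'.val % 2 ^ k ∧
          x.val % 2 ^ (k+1) ≠ x'.val % 2 ^ (k+1) then √(f x) * √(f x') else 0) := by
        apply sum_congr rfl; intro x _
        exact Equiv.sum_comp (Equiv.addLeft x) (fun x' => (if x.val % 2 ^ k = x'.val % 2 ^ k ∧
          x.val % 2 ^ (k+1) ≠ x'.val % 2 ^ (k+1) then √(f x) * √(f x') else 0))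
    _ = _ := pair_diff r k (fun x => √(f x))
    _ ≤ _ := by
        rw [mul_sum, mul_sum]
        apply sum_le_sum; intro a _
        have h1 := sqrt_coset r (k+1) a hk hf
        have h2 := sqrt_coset r (k+1) (a + 2 ^ k) hk hf
        have h3 := mul_le_mul h1 h2
          (cosetSum_nonneg r (k+1) (fun x => Real.sqrt_nonneg _) _) (by positivity)
        have h4 : √((2:ℝ) ^ (r - (k+1))) * √((2:ℝ) ^ (r - (k+1))) = 2 ^ (r - k - 1) :=
          Real.mul_self_sqrt (by positivity)
        rw [← h4]
        linarith

theorem per_y_N (r : ℕ) {f : ZMod (2 ^ r) → ℝ} (hf : ∀ x, 0 ≤ f x) (n : ℕ) :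
    Real.log 2 * ∑ k ∈ range n, ((∑ x, f x) - ∑ a ∈ range (2 ^ k),
        |cosetSum r (k+1) f a - cosetSum r (k+1) f (a + 2 ^ k)|) ≤
      ∑ a ∈ range (2 ^ n), Real.negMulLog (cosetSum r n f a) - Real.negMulLog (∑ x, f x) := by
  induction n with
  | zero => 
    have := sum_cosetSum r 0 f
    simp only [pow_zero, sum_range_one] at this
    simp [this]
  | succ k ih =>
    rw [sum_range_succ, mul_add]
    have h : Real.log 2 * ((∑ x, f x) - ∑ a ∈ range (2 ^ k),
        |cosetSum r (k+1) f a - cosetSum r (k+1) f (a + 2 ^ k)|) ≤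
      ∑ a ∈ range (2 ^ (k+1)), Real.negMulLog (cosetSum r (k+1) f a)
        - ∑ a ∈ range (2 ^ k), Real.negMulLog (cosetSum r k f a) := by
      rw [range_split, ← sum_cosetSum r k f, ← sum_sub_distrib, ← sum_sub_distrib, mul_sum]
      apply sum_le_sum
      intro a ha
      rw [cosetSum_split r k f a (by simpa using ha)]
      exact bin_aux2 (cosetSum_nonneg _ _ hf _) (cosetSum_nonneg _ _ hf _)
    linarith

theorem per_y_cap (r : ℕ) {f : ZMod (2 ^ r) → ℝ} (hf : ∀ x, 0 ≤ f x) :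
    ∑ x, f x * Real.logb 2 (f x / ∑ x', (1 / ((2 ^ r : ℕ) : ℝ)) * f x') ≤
      ∑ k ∈ range r, ∑ a ∈ range (2 ^ k),
        |cosetSum r (k+1) f a - cosetSum r (k+1) f (a + 2 ^ k)| := by
  have hl : 0 < Real.log 2 := Real.log_pos (by norm_num)
  have h := per_y_N r hf r
  rw [sum_range_top] at h
  simp only [cosetSum_top, sum_sub_distrib, sum_const, card_range, nsmul_eq_mul] at h
  have e : ∀ x, f x * Real.logb 2 (f x / ∑ x', (1 / ((2 ^ r : ℕ) : ℝ)) * f x')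
      = (-Real.negMulLog (f x) + f x * (r * Real.log 2 - Real.log (∑ x, f x))) / Real.log 2 := by
    intro x
    rcases eq_or_lt_of_le (hf x) with h0 | h0
    · simp [← h0]
    · have hS : 0 < ∑ x, f x := sum_pos' (fun x _ => hf x) ⟨x, mem_univ _, h0⟩
      rw [← mul_sum, Real.logb, Real.log_div h0.ne' (by positivity),
        Real.log_mul (by positivity) hS.ne', Real.negMulLog]
      rw [one_div, Real.log_inv, Nat.cast_pow, Real.log_pow]
      push_cast
      ring
  simp only [e]
  rw [← sum_div, div_le_iff₀ hl, sum_add_distrib, ← sum_mul, sum_neg_distrib]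
  have : Real.negMulLog (∑ x, f x) = - (∑ x, f x) * Real.log (∑ x, f x) := rfl
  rw [this] at h
  linarith

theorem layer (r k : ℕ) (hk : k < r) {Y : Type*} [Fintype Y]
    (W : ZMod (2 ^ r) → Y → ℝ) (hW : IsDMC W) :
    (1 / ((2 ^ r : ℕ) : ℝ)) * ∑ y, ∑ a ∈ range (2 ^ k),
      |cosetSum r (k+1) (fun x => W x y) a - cosetSum r (k+1) (fun x => W x y) (a + 2 ^ k)| ≤
    √(1 - Zi r W (r - k) ^ 2) := by
  obtain ⟨h0, h1⟩ := hW
  obtain ⟨A, hA⟩ : ∃ A : Y × ℕ → ℝ, A = fun p => cosetSum r (k+1) (fun x => W x p.1) p.2 :=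
    ⟨_, rfl⟩
  obtain ⟨B, hB⟩ : ∃ B : Y × ℕ → ℝ, B = fun p => cosetSum r (k+1) (fun x => W x p.1) (p.2 + 2 ^ k) :=
    ⟨_, rfl⟩
  obtain ⟨s, hs⟩ : ∃ s : Finset (Y × ℕ), s = univ ×ˢ range (2 ^ k) := ⟨_, rfl⟩
  obtain ⟨q, hq⟩ : ∃ q : ℝ, q = ((2 ^ r : ℕ) : ℝ) := ⟨_, rfl⟩
  have hq0 : 0 < q := by rw [hq]; positivity
  have hA0 : ∀ p, 0 ≤ A p := by rw [hA]; exact fun p => cosetSum_nonneg _ _ (fun x => h0 x _) _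
  have hB0 : ∀ p, 0 ≤ B p := by rw [hB]; exact fun p => cosetSum_nonneg _ _ (fun x => h0 x _) _
  have hAB : ∑ p ∈ s, (A p + B p) = q := by
    rw [hs, sum_product, hA, hB]
    simp only
    have : ∀ y, ∑ a ∈ range (2 ^ k), (cosetSum r (k+1) (fun x => W x y) a +
        cosetSum r (k+1) (fun x => W x y) (a + 2 ^ k)) = ∑ x, W x y := by
      intro y
      rw [← range_split, sum_cosetSum]
    simp only [this]
    rw [sum_comm]
    simp [h1, hq, ZMod.card]
  obtain ⟨T, hT⟩ : ∃ T, T = ∑ p ∈ s, √(A p) * √(B p) := ⟨_, rfl⟩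
  have hZ0 : 0 ≤ Zi r W (r - k) := by
    unfold Zi Zv bhat
    positivity
  have hZ : Zi r W (r - k) ≤ 2 * T / q := by
    unfold Zi Zv bhat
    rw [← mul_sum, ← hq]
    have e : ∑ v ∈ univ.filter (fun v : ZMod (2 ^ r) => v ≠ 0 ∧ owt r v = r - k),
        ∑ x, ∑ y, √(W x y * W (x + v) y) ≤ 2 ^ (r - k - 1) * (2 * T) := by
      calc _ = ∑ y, ∑ v ∈ univ.filter (fun v : ZMod (2 ^ r) => v ≠ 0 ∧ owt r v = r - k),
            ∑ x, √(W x y * W (x + v) y) := by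
            conv_rhs => rw [sum_comm]
            apply sum_congr rfl; intro v _
            rw [sum_comm]
        _ ≤ _ := sum_le_sum (fun y _ => per_y_Z r k hk (f := fun x => W x y) (fun x => h0 x y))
        _ = _ := by
            rw [← mul_sum, ← mul_sum, hT, hs, sum_product, hA, hB]
    rw [← mul_assoc, le_div_iff₀ hq0]
    calc _ = (1 / 2 ^ (r - k - 1)) * ∑ v ∈ univ.filter (fun v : ZMod (2 ^ r) => v ≠ 0 ∧ owt r v = r - k),
        ∑ x, ∑ y, √(W x y * W (x + v) y) := by field_simp
      _ ≤ (1 / 2 ^ (r - k - 1)) * (2 ^ (r - k - 1) * (2 * T)) := by gcongr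
      _ = _ := by field_simp
  have key : ∑ p ∈ s, |A p - B p| ≤ √(q - 2 * T) * √(q + 2 * T) := by
    have e1 : ∑ p ∈ s, |√(A p) - √(B p)| ^ 2 = q - 2 * T := by
      rw [← hAB, hT, mul_sum, ← sum_sub_distrib]
      apply sum_congr rfl; intro p _
      rw [sq_abs, sub_sq, Real.sq_sqrt (hA0 p), Real.sq_sqrt (hB0 p)]; ring
    have e2 : ∑ p ∈ s, (√(A p) + √(B p)) ^ 2 = q + 2 * T := by
      rw [← hAB, hT, mul_sum, ← sum_add_distrib]
      apply sum_congr rfl; intro p _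
      rw [add_sq, Real.sq_sqrt (hA0 p), Real.sq_sqrt (hB0 p)]; ring
    rw [← e1, ← e2]
    refine le_trans (le_of_eq ?_) (Real.sum_mul_le_sqrt_mul_sqrt _ _ _)
    apply sum_congr rfl; intro p _
    rw [← abs_of_nonneg (add_nonneg (Real.sqrt_nonneg (A p)) (Real.sqrt_nonneg (B p))), ← abs_mul]
    congr 1
    nlinarith [Real.sq_sqrt (hA0 p), Real.sq_sqrt (hB0 p)]
  have hT0 : 0 ≤ T := by rw [hT]; positivity
  have e0 : ∑ y, ∑ a ∈ range (2 ^ k),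
      |cosetSum r (k+1) (fun x => W x y) a - cosetSum r (k+1) (fun x => W x y) (a + 2 ^ k)|
      = ∑ p ∈ s, |A p - B p| := by
    rw [hs, sum_product, hA, hB]
  rw [e0, ← hq]
  calc _ ≤ 1 / q * (√(q - 2 * T) * √(q + 2 * T)) := by gcongr
    _ = √(1 - (2 * T / q) ^ 2) := by
      have : 1 - (2 * T / q) ^ 2 = (1 / q) ^ 2 * ((q - 2 * T) * (q + 2 * T)) := by
        field_simp; ring
      rw [this, Real.sqrt_mul (by positivity), Real.sqrt_sq (by positivity),
        Real.sqrt_mul' _ (by positivity)]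
    _ ≤ _ := by
      apply Real.sqrt_le_sqrt
      gcongr

/-- `I(W) ≤ ∑_{i=1}^r √(1 - Z_i(W)²)`. -/
theorem capacity_upper_bound (r : ℕ) (hr : 1 ≤ r) {Y : Type*} [Fintype Y] [Nonempty Y]
    (W : ZMod (2 ^ r) → Y → ℝ) (hW : IsDMC W) :
    symCap W ≤ ∑ i ∈ Finset.Icc 1 r, Real.sqrt (1 - (Zi r W i) ^ 2) := by
  have h1 : symCap W = (1 / ((2 ^ r : ℕ) : ℝ)) * ∑ y, ∑ x, W x y *
      Real.logb 2 (W x y / ∑ x', (1 / ((2 ^ r : ℕ) : ℝ)) * W x' y) := by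
    unfold symCap
    rw [sum_comm, mul_sum]
    apply sum_congr rfl; intro y _
    rw [mul_sum]
    apply sum_congr rfl; intro x _
    rw [mul_assoc]
  have h2 : ∑ i ∈ Finset.Icc 1 r, Real.sqrt (1 - (Zi r W i) ^ 2)
      = ∑ k ∈ range r, Real.sqrt (1 - (Zi r W (r - k)) ^ 2) := by
    symm
    apply sum_bij' (fun k _ => r - k) (fun i _ => r - i)
    · intro k hk; simp only [mem_range, mem_Icc] at *; omega
    · intro k hk; simp only [mem_range, mem_Icc] at *; omega
    · intro k hk; simp only [mem_range] at *; omega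
    · intro k hk; simp only [mem_Icc] at *; omega
    · intros; rfl
  rw [h1, h2]
  calc _ ≤ (1 / ((2 ^ r : ℕ) : ℝ)) * ∑ y, ∑ k ∈ range r, ∑ a ∈ range (2 ^ k),
        |cosetSum r (k+1) (fun x => W x y) a - cosetSum r (k+1) (fun x => W x y) (a + 2 ^ k)| := by
        apply mul_le_mul_of_nonneg_left _ (by positivity)
        exact sum_le_sum (fun y _ => per_y_cap r (f := fun x => W x y) (fun x => hW.1 x y))
    _ = ∑ k ∈ range r, (1 / ((2 ^ r : ℕ) : ℝ)) * ∑ y, ∑ a ∈ range (2 ^ k),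
        |cosetSum r (k+1) (fun x => W x y) a - cosetSum r (k+1) (fun x => W x y) (a + 2 ^ k)| := by
        rw [sum_comm, mul_sum]
    _ ≤ _ := sum_le_sum (fun k hk => layer r k (by simpa using hk) W hW)
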